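/- Let T be a sectorial operator in a separable complex Hilbert space H with T^{-1} ∈ B(H), and let S be a closed operator in H with dom(S) ⊇ dom(T) and dom(S*) ⊇ dom(T*). Then: (i) T^{-1}ST is well-defined on dom(T^2) and hence densely defined in H; (ii) (T^{-1}ST)* = T* S* (T*)^{-1}, so that T*S*(T*)^{-1} is closed in H; and (iii) T^{-1}ST is bounded if and only if (T^{-1}ST)* = T*S*(T*)^{-1} ∈ B(H), in which case cl(T^{-1}ST) = (T*S*(T*)^{-1})* and ||cl(T^{-1}ST)||_{B(H)} = ||T*S*(T*)^{-1}||_{B(H)}. -/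

import Mathlib

noncomputable section

open scoped ENNReal InnerProductSpace

namespace OpInterp

section Mcomp

variable {R E F G : Type*} [CommRing R] [AddCommGroup E] [Module R E]
  [AddCommGroup F] [Module R F] [AddCommGroup G] [Module R G]

/-- The maximal domain of the composition `g ∘ f` of two partial linear maps. -/
def mcompDomain (g : F →ₗ.[R] G) (f : E →ₗ.[R] F) : Submodule R E where
  carrier := {x | ∃ hx : x ∈ f.domain, f ⟨x, hx⟩ ∈ g.domain}
  zero_mem' := ⟨f.domain.zero_mem, by
    have h0 : (⟨(0 : E), f.domain.zero_mem⟩ : f.domain) = 0 := rfl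
    rw [h0, f.map_zero]; exact g.domain.zero_mem⟩
  add_mem' := by
    rintro x y ⟨hx, hfx⟩ ⟨hy, hfy⟩
    refine ⟨f.domain.add_mem hx hy, ?_⟩
    have h : (⟨x + y, f.domain.add_mem hx hy⟩ : f.domain) = ⟨x, hx⟩ + ⟨y, hy⟩ := rfl
    rw [h, f.map_add]
    exact g.domain.add_mem hfx hfy
  smul_mem' := by
    rintro c x ⟨hx, hfx⟩
    refine ⟨f.domain.smul_mem c hx, ?_⟩
    have h : (⟨c • x, f.domain.smul_mem c hx⟩ : f.domain) = c • (⟨x, hx⟩ : f.domain) := rfl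
    rw [h, f.map_smul]
    exact g.domain.smul_mem c hfx

theorem mem_mcompDomain {g : F →ₗ.[R] G} {f : E →ₗ.[R] F} {x : E} :
    x ∈ mcompDomain g f ↔ ∃ hx : x ∈ f.domain, f ⟨x, hx⟩ ∈ g.domain := Iff.rfl

/-- The inclusion of the maximal composition domain into the domain of `f`. -/
def mcompIncl (g : F →ₗ.[R] G) (f : E →ₗ.[R] F) : mcompDomain g f →ₗ[R] f.domain where
  toFun x := ⟨(x : E), x.2.choose⟩
  map_add' x y := Subtype.ext rfl
  map_smul' c x := Subtype.ext rfl

theorem mcompIncl_mem (g : F →ₗ.[R] G) (f : E →ₗ.[R] F) (x : mcompDomain g f) :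
    f (mcompIncl g f x) ∈ g.domain := by
  exact x.2.choose_spec

/-- The maximally defined composition of two partial linear maps: its domain consists of
all `x ∈ dom f` with `f x ∈ dom g`. -/
def mcomp (g : F →ₗ.[R] G) (f : E →ₗ.[R] F) : E →ₗ.[R] G where
  domain := mcompDomain g f
  toFun := g.toFun.comp ((f.toFun.comp (mcompIncl g f)).codRestrict g.domain
    fun x => mcompIncl_mem g f x)

theorem mcomp_domain (g : F →ₗ.[R] G) (f : E →ₗ.[R] F) :
    (mcomp g f).domain = mcompDomain g f := rfl

end Mcomp

section Hilbert

variable {E F G : Type*} [NormedAddCommGroup E] [InnerProductSpace ℂ E]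
  [NormedAddCommGroup F] [InnerProductSpace ℂ F]
  [NormedAddCommGroup G] [InnerProductSpace ℂ G]

/-- `B ∈ B(F,E)` is the (everywhere defined, bounded) inverse of the partial linear
map `T`; this encodes the hypothesis `T⁻¹ ∈ B(H)`. -/
def IsBoundedInverse (T : E →ₗ.[ℂ] F) (B : F →L[ℂ] E) : Prop :=
  (∀ x : T.domain, B (T x) = x) ∧ ∀ y : F, ∃ hy : B y ∈ T.domain, T ⟨B y, hy⟩ = y

/-- `C = S ∘ B` holds, where the bounded operator `B` maps into the domain of `S`;
this encodes hypotheses such as `S T⁻¹ ∈ B(H)` with `B = T⁻¹` and `C = S T⁻¹`. -/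
def IsComposition (S : E →ₗ.[ℂ] F) (B : G →L[ℂ] E) (C : G →L[ℂ] F) : Prop :=
  ∀ y : G, ∃ hy : B y ∈ S.domain, S ⟨B y, hy⟩ = C y

/-- The bounded operator `B` extends the partial linear map `Y`.  If `Y` is densely
defined this says precisely that `Y` is closable with bounded closure `B` (on all of `H`). -/
def ExtendsTo (Y : E →ₗ.[ℂ] F) (B : E →L[ℂ] F) : Prop :=
  ∀ x : Y.domain, Y x = B x

/-- The partial linear map `Y` is bounded on its domain. -/
def IsBddPMap (Y : E →ₗ.[ℂ] F) : Prop :=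
  ∃ c : ℝ, ∀ x : Y.domain, ‖Y x‖ ≤ c * ‖(x : E)‖

/-- `Y ∈ B(H)`: the partial linear map `Y` is everywhere defined and given by the
bounded operator `B`. -/
def IsBoundedOp (Y : E →ₗ.[ℂ] F) (B : E →L[ℂ] F) : Prop :=
  Y.domain = ⊤ ∧ ExtendsTo Y B

/-- Nonnegativity (`T ≥ 0`) of a partial linear map on a complex Hilbert space. -/
def IsNonnegPMap (T : E →ₗ.[ℂ] E) : Prop :=
  ∀ x : T.domain, 0 ≤ (⟪(x : E), T x⟫_ℂ).re ∧ (⟪(x : E), T x⟫_ℂ).im = 0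

/-- The `n`-th approximation number of a bounded operator; for operators between Hilbert
spaces these are exactly the singular values `s_{n+1}(A)`. -/
def approxNumber (A : E →L[ℂ] F) (n : ℕ) : ℝ :=
  sInf {c : ℝ | ∃ B : E →L[ℂ] F, Module.finrank ℂ (LinearMap.range (B : E →ₗ[ℂ] F)) ≤ n ∧
    ‖A - B‖ = c}

/-- The Schatten–von Neumann `p`-norm `‖A‖_{B_p}` (`= (∑ s_n(A)^p)^{1/p}`), valued in
`[0,∞]`; for `p = ∞` it is the operator norm. -/
def schattenNorm (p : ℝ≥0∞) (A : E →L[ℂ] F) : ℝ≥0∞ :=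
  if p = ∞ then (‖A‖₊ : ℝ≥0∞)
  else (∑' n : ℕ, ENNReal.ofReal (approxNumber A n) ^ p.toReal) ^ (1 / p.toReal)

/-- Membership in the Schatten–von Neumann ideal `B_p`. -/
def MemSchatten (p : ℝ≥0∞) (A : E →L[ℂ] F) : Prop :=
  schattenNorm p A ≠ ∞

end Hilbert

/-- The open strip `Σ = {z : 0 < Re z < 1}`. -/
def strip : Set ℂ := {z : ℂ | z.re ∈ Set.Ioo (0 : ℝ) 1}

/-- The closed strip `Σ̄ = {z : 0 ≤ Re z ≤ 1}`. -/
def closedStrip : Set ℂ := {z : ℂ | z.re ∈ Set.Icc (0 : ℝ) 1}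

end OpInterp
section Structures

variable {E F : Type*} [NormedAddCommGroup E] [InnerProductSpace ℂ E] [CompleteSpace E]
  [NormedAddCommGroup F] [InnerProductSpace ℂ F] [CompleteSpace F]

namespace OpInterp

/-- `Q` is the family of real powers `α ↦ R^α` of the nonnegative self-adjoint operator `R`,
as provided by the spectral theorem (these properties characterize it uniquely). -/
structure IsRealPowerFamily (R : E →ₗ.[ℂ] E) (Q : ℝ → E →ₗ.[ℂ] E) : Prop where
  zero : Q 0 = (LinearMap.id : E →ₗ[ℂ] E).toPMap ⊤
  one : Q 1 = R
  selfAdjoint : ∀ a : ℝ, 0 ≤ a → IsSelfAdjoint (Q a)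
  nonneg : ∀ a : ℝ, 0 ≤ a → IsNonnegPMap (Q a)
  semigroup : ∀ a b : ℝ, 0 ≤ a → 0 ≤ b → mcomp (Q a) (Q b) = Q (a + b)
  domain_antitone : ∀ a b : ℝ, 0 ≤ a → a ≤ b → (Q b).domain ≤ (Q a).domain

/-- `P` is the family `z ↦ T^{-z}` (`Re z ≥ 0`) of complex powers of the boundedly
invertible self-adjoint operator `T`, defined by the spectral theorem of `T` via the branch
`λ^z = λ^{Re z} e^{i Im z ln|λ|}[θ(λ) + e^{-π Im z}θ(-λ)]`. -/
structure IsSpectralInvPowers (T : E →ₗ.[ℂ] E) (Tinv : E →L[ℂ] E)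
    (P : ℂ → E →L[ℂ] E) : Prop where
  zero : P 0 = 1
  one : P 1 = Tinv
  semigroup : ∀ z w : ℂ, 0 ≤ z.re → 0 ≤ w.re → P (z + w) = P z ∘L P w
  /-- `‖T^{iy}‖ ≤ max (1, e^{-π y})`, i.e. `‖P (i s)‖ = ‖T^{-i s}‖ ≤ max (1, e^{π s})`. -/
  norm_imaginary : ∀ s : ℝ, ‖P (Complex.I * s)‖ ≤ max 1 (Real.exp (Real.pi * s))
  norm_le : ∀ z : ℂ, z.re ∈ Set.Icc (0 : ℝ) 1 →
    ‖P z‖ ≤ max 1 ‖Tinv‖ * max 1 (Real.exp (Real.pi * |z.im|))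
  /-- if `T ≥ 0` then the imaginary powers are unitary. -/
  isometry_imaginary_of_nonneg : IsNonnegPMap T → ∀ (s : ℝ) (x : E),
    ‖P (Complex.I * s) x‖ = ‖x‖
  strong_continuous : ∀ x : E, ContinuousOn (fun z => P z x) {z : ℂ | 0 ≤ z.re}
  analytic : ∀ x : E, DifferentiableOn ℂ (fun z => P z x) {z : ℂ | 0 < z.re}
  mapsTo_domain : ∀ z : ℂ, 0 ≤ z.re → ∀ x : E, x ∈ T.domain → P z x ∈ T.domain
  commutes : ∀ z : ℂ, 0 ≤ z.re → ∀ x : T.domain,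
    ∀ hx : P z (x : E) ∈ T.domain, T ⟨P z (x : E), hx⟩ = P z (T x)

/-- `R = |S| = (S^*S)^{1/2}`, the modulus of the densely defined closed operator `S`
(these properties characterize `|S|` uniquely). -/
structure IsModulus (S : E →ₗ.[ℂ] F) (R : E →ₗ.[ℂ] E) : Prop where
  selfAdjoint : IsSelfAdjoint R
  nonneg : IsNonnegPMap R
  domain_eq : R.domain = S.domain
  norm_eq : ∀ (x : R.domain) (hx : (x : E) ∈ S.domain), ‖R x‖ = ‖S ⟨(x : E), hx⟩‖

/-- `U = U_S`, the partial isometry in the polar decomposition `S = U_S |S|`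
(with `R = |S|` and initial space `cl (ran |S|)`). -/
structure IsPolarPartialIsometry (S : E →ₗ.[ℂ] F) (R : E →ₗ.[ℂ] E) (U : E →L[ℂ] F) :
    Prop where
  map_eq : ∀ (x : S.domain) (hx : (x : E) ∈ R.domain), U (R ⟨(x : E), hx⟩) = S x
  norm_map : ∀ x : R.domain, ‖U (R x)‖ = ‖R x‖
  ker_perp : ∀ y : E, (∀ x : R.domain, ⟪R x, y⟫_ℂ = 0) → U y = 0

/-- The open sector `S_ω` with vertex `0`, opening half-angle `ω`, along the positive
real axis; `S_0 = (0,∞)`. -/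
def sector (ω : ℝ) : Set ℂ :=
  if ω = 0 then {z : ℂ | z ≠ 0 ∧ Complex.arg z = 0}
  else {z : ℂ | z ≠ 0 ∧ |Complex.arg z| < ω}

/-- `R = (T - ζ)⁻¹ ∈ B(H)`, i.e. `ζ` belongs to the resolvent set of `T` with
resolvent `R`. -/
def IsResolventAt (T : E →ₗ.[ℂ] E) (ζ : ℂ) (R : E →L[ℂ] E) : Prop :=
  (∀ x : T.domain, R (T x - ζ • (x : E)) = x) ∧
    ∀ y : E, ∃ hy : R y ∈ T.domain, T ⟨R y, hy⟩ - ζ • R y = y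

/-- The resolvent set of the partial linear map `T`. -/
def presolventSet (T : E →ₗ.[ℂ] E) : Set ℂ :=
  {ζ : ℂ | ∃ R : E →L[ℂ] E, IsResolventAt T ζ R}

/-- The spectrum of the partial linear map `T`. -/
def pspectrum (T : E →ₗ.[ℂ] E) : Set ℂ := (presolventSet T)ᶜ

/-- `T` is a (densely defined, closed) sectorial operator of angle `ω ∈ [0,π)`. -/
structure IsSectorial (T : E →ₗ.[ℂ] E) (ω : ℝ) : Prop where
  denseDomain : Dense (T.domain : Set E)
  isClosed : T.IsClosed
  angle_mem : ω ∈ Set.Ico (0 : ℝ) Real.pi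
  spectrum_subset : pspectrum T ⊆ closure (sector ω)
  resolvent_bound : ∀ ω' ∈ Set.Ioo ω Real.pi, ∃ M : ℝ,
    ∀ ζ ∉ closure (sector ω'), ∀ R : E →L[ℂ] E, IsResolventAt T ζ R → ‖ζ • R‖ ≤ M

/-- `P` is the family `z ↦ T^{-z}` (`Re z ≥ 0`) of fractional powers of the sectorial
operator `T` (defined via the Dunford integral for `Re z > 0` and by strong limits on the
boundary), with bounded imaginary powers: `T ∈ BIP(N,θ)`,
`‖T^{is}‖ = ‖P (-is)‖ ≤ N e^{θ|s|}`. -/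
structure IsBIPInvPowers (T : E →ₗ.[ℂ] E) (Tinv : E →L[ℂ] E) (N θ : ℝ)
    (P : ℂ → E →L[ℂ] E) : Prop where
  zero : P 0 = 1
  one : P 1 = Tinv
  semigroup : ∀ z w : ℂ, 0 ≤ z.re → 0 ≤ w.re → P (z + w) = P z ∘L P w
  bip : ∀ s : ℝ, ‖P (Complex.I * s)‖ ≤ N * Real.exp (θ * |s|)
  strong_continuous : ∀ x : E, ContinuousOn (fun z => P z x) {z : ℂ | 0 ≤ z.re}
  analytic : ∀ x : E, DifferentiableOn ℂ (fun z => P z x) {z : ℂ | 0 < z.re}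
  mapsTo_domain : ∀ z : ℂ, 0 ≤ z.re → ∀ x : E, x ∈ T.domain → P z x ∈ T.domain
  commutes : ∀ z : ℂ, 0 ≤ z.re → ∀ x : T.domain,
    ∀ hx : P z (x : E) ∈ T.domain, T ⟨P z (x : E), hx⟩ = P z (T x)

end OpInterp

end Structures

namespace LinearPMap

section Topology

variable {E F : Type*} [NormedAddCommGroup E] [NormedSpace ℂ E]
  [NormedAddCommGroup F] [NormedSpace ℂ F]

theorem closure_eq_of_graph_topologicalClosure_eq {f g : E →ₗ.[ℂ] F}
    (h : f.graph.topologicalClosure = g.graph) : f.closure = g := by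
  have hf : f.IsClosable := ⟨g, h⟩
  exact eq_of_eq_graph (hf.graph_closure_eq_closure_graph.symm.trans h)

theorem mem_graph_toPMap_top_iff (B : E →ₗ[ℂ] F) (x : E) (y : F) :
    (x, y) ∈ (B.toPMap ⊤).graph ↔ B x = y := by
  simp [mem_graph_iff]

end Topology

section Adjoint

variable {E F : Type*} [NormedAddCommGroup E] [InnerProductSpace ℂ E] [CompleteSpace E]
  [NormedAddCommGroup F] [InnerProductSpace ℂ F]

theorem mem_graph_adjoint_iff {f : E →ₗ.[ℂ] F} (hf : Dense (f.domain : Set E)) (y : F) (w : E) :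
    (y, w) ∈ f.adjoint.graph ↔ ∀ x z, (x, z) ∈ f.graph → ⟪w, x⟫_ℂ = ⟪y, z⟫_ℂ := by
  rw [adjoint_graph_eq_graph_adjoint hf, Submodule.mem_adjoint_iff]
  refine forall₂_congr fun x z => imp_congr_right fun _ => ?_
  rw [sub_eq_zero, ← inner_conj_symm z y, ← inner_conj_symm x w, (starRingEnd ℂ).injective.eq_iff,
    eq_comm]

end Adjoint

end LinearPMap

namespace OpInterp

section Graphs

variable {R E F G : Type*} [CommRing R] [AddCommGroup E] [Module R E]
  [AddCommGroup F] [Module R F] [AddCommGroup G] [Module R G]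

theorem mem_graph_mcomp_iff (g : F →ₗ.[R] G) (f : E →ₗ.[R] F) (x : E) (z : G) :
    (x, z) ∈ (mcomp g f).graph ↔ ∃ y, (x, y) ∈ f.graph ∧ (y, z) ∈ g.graph := by
  simp only [LinearPMap.mem_graph_iff]
  constructor
  · rintro ⟨⟨x, hx, hfx⟩, rfl, rfl⟩
    exact ⟨f ⟨x, hx⟩, ⟨⟨x, hx⟩, rfl, rfl⟩, ⟨f ⟨x, hx⟩, hfx⟩, rfl, rfl⟩
  · rintro ⟨_, ⟨⟨x, hx⟩, rfl, rfl⟩, ⟨y, hy⟩, rfl, rfl⟩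
    exact ⟨⟨x, hx, hy⟩, rfl, rfl⟩

theorem mem_graph_compPMap_iff (g : F →ₗ[R] G) (f : E →ₗ.[R] F) (x : E) (z : G) :
    (x, z) ∈ (g.compPMap f).graph ↔ ∃ y, (x, y) ∈ f.graph ∧ g y = z := by
  simp only [LinearPMap.mem_graph_iff]
  constructor
  · rintro ⟨x, rfl, rfl⟩
    exact ⟨f x, ⟨x, rfl, rfl⟩, rfl⟩
  · rintro ⟨_, ⟨x, rfl, rfl⟩, rfl⟩
    exact ⟨x, rfl, rfl⟩

end Graphs

section BoundedOperators

variable {E F : Type*} [NormedAddCommGroup E] [InnerProductSpace ℂ E]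
  [NormedAddCommGroup F] [InnerProductSpace ℂ F]

theorem ExtendsTo.eq_toPMap {Y : E →ₗ.[ℂ] F} {B : E →L[ℂ] F} (h : ExtendsTo Y B) :
    Y = (B : E →ₗ[ℂ] F).toPMap Y.domain :=
  LinearPMap.ext rfl fun x hx _ => h ⟨x, hx⟩

theorem isBoundedOp_iff {Y : E →ₗ.[ℂ] F} {B : E →L[ℂ] F} :
    IsBoundedOp Y B ↔ Y = (B : E →ₗ[ℂ] F).toPMap ⊤ := by
  constructor
  · rintro ⟨hdom, hext⟩
    rw [← hdom]
    exact hext.eq_toPMap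
  · rintro rfl
    exact ⟨rfl, fun _ => rfl⟩

theorem isBoundedOp_toPMap_top_iff {A B : E →L[ℂ] F} :
    IsBoundedOp ((A : E →ₗ[ℂ] F).toPMap ⊤) B ↔ A = B := by
  refine ⟨fun h => ContinuousLinearMap.ext fun x => h.2 ⟨x, Submodule.mem_top⟩, ?_⟩
  rintro rfl
  exact ⟨rfl, fun _ => rfl⟩

theorem ExtendsTo.isBddPMap {Y : E →ₗ.[ℂ] F} {B : E →L[ℂ] F} (h : ExtendsTo Y B) :
    IsBddPMap Y :=
  ⟨‖B‖, fun x => by rw [h x]; exact B.le_opNorm x⟩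

theorem IsBddPMap.exists_extendsTo [CompleteSpace F] {Y : E →ₗ.[ℂ] F}
    (hY : Dense (Y.domain : Set E))
    (h : IsBddPMap Y) : ∃ B : E →L[ℂ] F, ExtendsTo Y B := by
  obtain ⟨c, hc⟩ := h
  refine ⟨(Y.toFun.mkContinuous c hc).extend Y.domain.subtypeL, fun x => ?_⟩
  exact (ContinuousLinearMap.extend_eq (Y.toFun.mkContinuous c hc) (e := Y.domain.subtypeL)
    hY.denseRange_val isUniformEmbedding_subtype_val.isUniformInducing x).symm

theorem ExtendsTo.closure_eq {Y : E →ₗ.[ℂ] F} {B : E →L[ℂ] F}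
    (hY : Dense (Y.domain : Set E)) (h : ExtendsTo Y B) :
    Y.closure = (B : E →ₗ[ℂ] F).toPMap ⊤ := by
  refine LinearPMap.closure_eq_of_graph_topologicalClosure_eq (le_antisymm ?_ ?_)
  · refine Submodule.topologicalClosure_minimal _ ?_ ?_
    · rintro ⟨x, y⟩ hxy
      obtain ⟨x, rfl, rfl⟩ := (LinearPMap.mem_graph_iff _).1 hxy
      exact (LinearPMap.mem_graph_toPMap_top_iff _ _ _).2 (h x).symm
    · have : (((B : E →ₗ[ℂ] F).toPMap ⊤).graph : Set (E × F)) = {p | B p.1 = p.2} := by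
        ext ⟨x, y⟩
        exact LinearPMap.mem_graph_toPMap_top_iff _ _ _
      rw [this]
      exact isClosed_eq (by fun_prop) (by fun_prop)
  · rintro ⟨x, y⟩ hxy
    obtain rfl := (LinearPMap.mem_graph_toPMap_top_iff _ _ _).1 hxy
    refine map_mem_closure (f := fun x => (x, B x)) (by fun_prop) (hY x) fun x hx => ?_
    exact (LinearPMap.mem_graph_iff _).2 ⟨⟨x, hx⟩, rfl, h ⟨x, hx⟩⟩

variable [CompleteSpace E] [CompleteSpace F]

theorem ExtendsTo.adjoint_eq {Y : E →ₗ.[ℂ] F} {B : E →L[ℂ] F}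
    (hY : Dense (Y.domain : Set E)) (h : ExtendsTo Y B) :
    Y.adjoint = (B.adjoint : F →ₗ[ℂ] E).toPMap ⊤ := by
  rw [h.eq_toPMap]
  exact B.toPMap_adjoint_eq_adjoint_toPMap_of_dense hY

theorem extendsTo_adjoint_of_isBoundedOp_adjoint {Y : E →ₗ.[ℂ] F} {B : F →L[ℂ] E}
    (hY : Dense (Y.domain : Set E)) (h : IsBoundedOp Y.adjoint B) :
    ExtendsTo Y B.adjoint := by
  intro x
  refine ext_inner_left ℂ fun y => ?_
  have hy : y ∈ Y.adjoint.domain := h.1 ▸ Submodule.mem_top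
  rw [B.adjoint_inner_right, ← LinearPMap.adjoint_isFormalAdjoint hY ⟨y, hy⟩ x, h.2 ⟨y, hy⟩]

theorem isBddPMap_iff_exists_isBoundedOp_adjoint {Y : E →ₗ.[ℂ] F}
    (hY : Dense (Y.domain : Set E)) :
    IsBddPMap Y ↔ ∃ B : F →L[ℂ] E, IsBoundedOp Y.adjoint B := by
  constructor
  · intro h
    obtain ⟨B, hB⟩ := h.exists_extendsTo hY
    exact ⟨B.adjoint, isBoundedOp_iff.2 (hB.adjoint_eq hY)⟩
  · rintro ⟨B, hB⟩
    exact (extendsTo_adjoint_of_isBoundedOp_adjoint hY hB).isBddPMap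

theorem IsBddPMap.closure_eq_adjoint_adjoint {Y : E →ₗ.[ℂ] F}
    (hY : Dense (Y.domain : Set E)) (h : IsBddPMap Y) : Y.closure = Y.adjoint.adjoint := by
  obtain ⟨B, hB⟩ := h.exists_extendsTo hY
  rw [hB.closure_eq hY, hB.adjoint_eq hY,
    B.adjoint.toPMap_adjoint_eq_adjoint_toPMap_of_dense (by simp),
    ContinuousLinearMap.adjoint_adjoint]

theorem ExtendsTo.norm_eq_of_isBoundedOp_adjoint {Y : E →ₗ.[ℂ] F} {A : E →L[ℂ] F}
    {B : F →L[ℂ] E} (hY : Dense (Y.domain : Set E)) (hA : ExtendsTo Y A)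
    (hB : IsBoundedOp Y.adjoint B) : ‖A‖ = ‖B‖ := by
  rw [hA.adjoint_eq hY, isBoundedOp_toPMap_top_iff] at hB
  rw [← hB]
  exact (LinearIsometryEquiv.norm_map ContinuousLinearMap.adjoint A).symm

end BoundedOperators

section Similarity

variable {H : Type*} [NormedAddCommGroup H] [InnerProductSpace ℂ H]
  {T S : H →ₗ.[ℂ] H} {Tinv : H →L[ℂ] H}

theorem IsBoundedInverse.mem_graph_iff (hTinv : IsBoundedInverse T Tinv) (x u : H) :
    (x, u) ∈ T.graph ↔ Tinv u = x := by
  rw [LinearPMap.mem_graph_iff]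
  constructor
  · rintro ⟨x, rfl, rfl⟩
    exact hTinv.1 x
  · rintro rfl
    obtain ⟨hu, h⟩ := hTinv.2 u
    exact ⟨⟨Tinv u, hu⟩, rfl, h⟩

theorem IsBoundedInverse.range_eq (hTinv : IsBoundedInverse T Tinv) :
    Set.range Tinv = T.domain := by
  ext x
  constructor
  · rintro ⟨u, rfl⟩
    exact (hTinv.2 u).1
  · intro hx
    exact ⟨T ⟨x, hx⟩, hTinv.1 ⟨x, hx⟩⟩

theorem IsBoundedInverse.dense_mcomp_self_domain (hTinv : IsBoundedInverse T Tinv)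
    (hT : Dense (T.domain : Set H)) : Dense ((mcomp T T).domain : Set H) := by
  have hrange : DenseRange Tinv := by rwa [DenseRange, hTinv.range_eq]
  refine (hrange.dense_image Tinv.continuous hT).mono ?_
  rintro _ ⟨u, hu, rfl⟩
  obtain ⟨hx, hTx⟩ := hTinv.2 u
  refine ⟨hx, ?_⟩
  rw [hTx]
  exact hu

theorem IsBoundedInverse.mem_graph_adjoint_iff [CompleteSpace H]
    (hTinv : IsBoundedInverse T Tinv) (hT : Dense (T.domain : Set H)) (y w : H) :
    (y, w) ∈ T.adjoint.graph ↔ Tinv.adjoint w = y := by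
  simp only [LinearPMap.mem_graph_adjoint_iff hT, hTinv.mem_graph_iff]
  constructor
  · intro h
    refine ext_inner_right ℂ fun u => ?_
    rw [Tinv.adjoint_inner_left, h _ u rfl]
  · rintro rfl _ u rfl
    rw [Tinv.adjoint_inner_left]

theorem mem_graph_similarity_iff (hTinv : IsBoundedInverse T Tinv) (x z : H) :
    (x, z) ∈ ((Tinv : H →ₗ[ℂ] H).compPMap (mcomp S T)).graph ↔
      ∃ u v, (u, v) ∈ S.graph ∧ Tinv u = x ∧ Tinv v = z := by
  simp only [mem_graph_compPMap_iff, mem_graph_mcomp_iff, hTinv.mem_graph_iff,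
    ContinuousLinearMap.coe_coe]
  exact ⟨fun ⟨v, ⟨u, hu, huv⟩, hv⟩ => ⟨u, v, huv, hu, hv⟩,
    fun ⟨u, v, huv, hu, hv⟩ => ⟨v, ⟨u, hu, huv⟩, hv⟩⟩

theorem adjoint_similarity [CompleteSpace H] (hTinv : IsBoundedInverse T Tinv)
    (hT : Dense (T.domain : Set H)) (hS : Dense (S.domain : Set H))
    (hX : Dense (((Tinv : H →ₗ[ℂ] H).compPMap (mcomp S T)).domain : Set H)) :
    ((Tinv : H →ₗ[ℂ] H).compPMap (mcomp S T)).adjoint =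
      mcomp T.adjoint (mcomp S.adjoint ((Tinv.adjoint : H →ₗ[ℂ] H).toPMap ⊤)) := by
  refine LinearPMap.eq_of_eq_graph (Submodule.ext fun ⟨y, w⟩ => ?_)
  have hright : (y, w) ∈ (mcomp T.adjoint
      (mcomp S.adjoint ((Tinv.adjoint : H →ₗ[ℂ] H).toPMap ⊤))).graph ↔
      (Tinv.adjoint y, Tinv.adjoint w) ∈ S.adjoint.graph := by
    simp only [mem_graph_mcomp_iff, LinearPMap.mem_graph_toPMap_top_iff,
      hTinv.mem_graph_adjoint_iff hT, ContinuousLinearMap.coe_coe, exists_eq_left',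
      exists_eq_right']
  rw [hright, LinearPMap.mem_graph_adjoint_iff hX, LinearPMap.mem_graph_adjoint_iff hS]
  simp only [mem_graph_similarity_iff hTinv, ContinuousLinearMap.adjoint_inner_left]
  constructor
  · exact fun h u v huv => h _ _ ⟨u, v, huv, rfl, rfl⟩
  · rintro h _ _ ⟨u, v, huv, rfl, rfl⟩
    exact h u v huv

end Similarity

end OpInterp

open OpInterp in
/-- Theorem 4.3.  Let `T` be sectorial in `H` with `T⁻¹ ∈ B(H)` and `S`
closed with `dom S ⊇ dom T`, `dom S* ⊇ dom T*`.  Then (i) `T⁻¹ST` is well defined on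
`dom T²`, hence densely defined; (ii) `(T⁻¹ST)* = T*S*(T*)⁻¹`, so `T*S*(T*)⁻¹` is closed;
(iii) `T⁻¹ST` is bounded iff `(T⁻¹ST)* = T*S*(T*)⁻¹ ∈ B(H)`, in which case
`cl(T⁻¹ST) = (T*S*(T*)⁻¹)*` and `‖cl(T⁻¹ST)‖ = ‖T*S*(T*)⁻¹‖`. -/
theorem statement16
    {H : Type*} [NormedAddCommGroup H] [InnerProductSpace ℂ H] [CompleteSpace H]
    [TopologicalSpace.SeparableSpace H]
    (T S : H →ₗ.[ℂ] H) (Tinv : H →L[ℂ] H) (ω : ℝ)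
    (hT : IsSectorial T ω) (hTinv : IsBoundedInverse T Tinv)
    (hS : S.IsClosed) (hSdense : Dense (S.domain : Set H))
    (hdomS : T.domain ≤ S.domain) (hdomS' : T.adjoint.domain ≤ S.adjoint.domain) :
    -- (i)
    (mcomp T T).domain ≤ (LinearMap.compPMap (Tinv : H →ₗ[ℂ] H) (mcomp S T)).domain ∧
    Dense ((LinearMap.compPMap (Tinv : H →ₗ[ℂ] H) (mcomp S T)).domain : Set H) ∧
    -- (ii) `(T⁻¹ST)* = T* S* (T*)⁻¹`, which is therefore closed:
    (LinearMap.compPMap (Tinv : H →ₗ[ℂ] H) (mcomp S T)).adjoint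
        = mcomp T.adjoint (mcomp S.adjoint
            (((ContinuousLinearMap.adjoint Tinv) : H →ₗ[ℂ] H).toPMap ⊤)) ∧
    (mcomp T.adjoint (mcomp S.adjoint
        (((ContinuousLinearMap.adjoint Tinv) : H →ₗ[ℂ] H).toPMap ⊤))).IsClosed ∧
    -- (iii)
    (IsBddPMap (LinearMap.compPMap (Tinv : H →ₗ[ℂ] H) (mcomp S T)) ↔
      ∃ B : H →L[ℂ] H,
        IsBoundedOp (mcomp T.adjoint (mcomp S.adjoint
          (((ContinuousLinearMap.adjoint Tinv) : H →ₗ[ℂ] H).toPMap ⊤))) B) ∧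
    (IsBddPMap (LinearMap.compPMap (Tinv : H →ₗ[ℂ] H) (mcomp S T)) →
      ((LinearMap.compPMap (Tinv : H →ₗ[ℂ] H) (mcomp S T)).closure
          = (mcomp T.adjoint (mcomp S.adjoint
              (((ContinuousLinearMap.adjoint Tinv) : H →ₗ[ℂ] H).toPMap ⊤))).adjoint ∧
        ∀ B : H →L[ℂ] H,
          IsBoundedOp (mcomp T.adjoint (mcomp S.adjoint
            (((ContinuousLinearMap.adjoint Tinv) : H →ₗ[ℂ] H).toPMap ⊤))) B →
          ∀ Bc : H →L[ℂ] H,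
            ExtendsTo (LinearMap.compPMap (Tinv : H →ₗ[ℂ] H) (mcomp S T)) Bc →
            ‖Bc‖ = ‖B‖)) := by
  have hle : (mcomp T T).domain ≤
      (LinearMap.compPMap (Tinv : H →ₗ[ℂ] H) (mcomp S T)).domain :=
    fun _ ⟨hx, hTx⟩ => ⟨hx, hdomS hTx⟩
  have hX : Dense ((LinearMap.compPMap (Tinv : H →ₗ[ℂ] H) (mcomp S T)).domain : Set H) :=
    (hTinv.dense_mcomp_self_domain hT.denseDomain).mono hle
  rw [← adjoint_similarity hTinv hT.denseDomain hSdense hX]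
  exact ⟨hle, hX, rfl, LinearPMap.adjoint_isClosed hX,
    isBddPMap_iff_exists_isBoundedOp_adjoint hX,
    fun h => ⟨h.closure_eq_adjoint_adjoint hX,
      fun _ hB _ hA => hA.norm_eq_of_isBoundedOp_adjoint hX hB⟩⟩
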